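/- arXiv:2510.24587 — 3 statements merged into one kernel-verified Lean document; each statement's English description precedes it below -/
import Mathlib

section
/- Let V be a real inner product space, let x ∈ V, let (x_j)_{j≥0} be a sequence in V with x₀ = 0, let κ ≥ 1, and set ρ = (√κ − 1)/(√κ + 1). Suppose ‖x_j − x‖ ≤ κ · (2 ρ^j / (1 + ρ^{2j})) · ‖x‖ for every j ≥ 0. Let 1 ≤ i_min ≤ i_max be integers and p : {i_min, …, i_max} → (0,1] with ∑_{j=i_min}^{i_max} p(j) = 1. Then (i) the mean of the TSS-Solve estimator equals x_{i_max}, i.e. ∑_{j=i_min}^{i_max} p(j) · ( (x_j − x_{j−1})/p(j) + x_{i_min−1} ) = x_{i_max}, and (ii) its variance satisfies ∑_{j=i_min}^{i_max} p(j) · ‖ (x_j − x_{j−1})/p(j) + x_{i_min−1} − x_{i_max} ‖² ≤ 16 κ² ‖x‖² Γ, where Γ = ∑_{j=i_min}^{i_max} ρ^{2(j−1)} / p(j). -/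
/-- Weighted second moments about the mean are at most those about the origin. -/
theorem sum_mul_norm_sub_mean_sq_le {ι V : Type*} [NormedAddCommGroup V] [InnerProductSpace ℝ V]
    (s : Finset ι) (p : ι → ℝ) (Y : ι → V) (hp : ∑ j ∈ s, p j = 1) :
    ∑ j ∈ s, p j * ‖Y j - ∑ i ∈ s, p i • Y i‖ ^ 2 ≤ ∑ j ∈ s, p j * ‖Y j‖ ^ 2 := by
  set m := ∑ i ∈ s, p i • Y i with hm
  have hinner : ∑ j ∈ s, p j * inner ℝ (Y j) m = ‖m‖ ^ 2 := by
    rw [← real_inner_self_eq_norm_sq]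
    nth_rw 2 [hm]
    rw [sum_inner]
    simp only [real_inner_smul_left]
  have hexpand : ∑ j ∈ s, p j * ‖Y j - m‖ ^ 2 =
      ∑ j ∈ s, p j * ‖Y j‖ ^ 2 - 2 * ∑ j ∈ s, p j * inner ℝ (Y j) m
        + (∑ j ∈ s, p j) * ‖m‖ ^ 2 := by
    rw [Finset.mul_sum, Finset.sum_mul, ← Finset.sum_sub_distrib, ← Finset.sum_add_distrib]
    refine Finset.sum_congr rfl fun j _ => ?_
    rw [norm_sub_sq_real]
    ring
  rw [hexpand, hinner, hp]
  nlinarith [sq_nonneg ‖m‖]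

theorem sum_Icc_sub_pred {V : Type*} [AddCommGroup V] (f : ℕ → V) {a b : ℕ}
    (hab : a ≤ b) :
    ∑ j ∈ Finset.Icc a b, (f j - f (j - 1)) = f b - f (a - 1) := by
  induction b, hab using Nat.le_induction with
  | base => simp
  | succ n hn ih =>
    rw [Finset.sum_Icc_succ_top (by omega), ih, Nat.add_sub_cancel]
    abel

/-- Consecutive iterates satisfying the conjugate gradient error bound are geometrically close. -/
theorem norm_sub_pred_le_of_cg_bound {V : Type*} [NormedAddCommGroup V]
    {x : V} {xs : ℕ → V} {κ ρ : ℝ} (hκ : 0 ≤ κ) (hρ0 : 0 ≤ ρ) (hρ1 : ρ ≤ 1)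
    (hbound : ∀ j : ℕ, ‖xs j - x‖ ≤ κ * (2 * ρ ^ j / (1 + ρ ^ (2 * j))) * ‖x‖)
    (j : ℕ) : ‖xs j - xs (j - 1)‖ ≤ 4 * κ * ‖x‖ * ρ ^ (j - 1) := by
  have hgeom : ∀ i, ‖xs i - x‖ ≤ κ * (2 * ρ ^ i) * ‖x‖ := fun i => by
    refine (hbound i).trans ?_
    gcongr
    exact div_le_self (by positivity) (le_add_of_nonneg_right (by positivity))
  have hpow : κ * (2 * ρ ^ j) * ‖x‖ ≤ κ * (2 * ρ ^ (j - 1)) * ‖x‖ := by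
    have := pow_le_pow_of_le_one hρ0 hρ1 (Nat.sub_le j 1)
    gcongr
  have htri := norm_sub_le_norm_sub_add_norm_sub (xs j) x (xs (j - 1))
  rw [norm_sub_rev x] at htri
  linarith [hgeom j, hgeom (j - 1)]


/-- Mean and variance of the TSS-Solve estimator. -/
theorem tss_solve_mean_variance {V : Type*} [NormedAddCommGroup V] [InnerProductSpace ℝ V]
    (x : V) (xs : ℕ → V) (hx0 : xs 0 = 0)
    (κ : ℝ) (hκ : 1 ≤ κ)
    (ρ : ℝ) (hρ : ρ = (Real.sqrt κ - 1) / (Real.sqrt κ + 1))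
    (hbound : ∀ j : ℕ, ‖xs j - x‖ ≤ κ * (2 * ρ ^ j / (1 + ρ ^ (2 * j))) * ‖x‖)
    (imin imax : ℕ) (h1 : 1 ≤ imin) (h2 : imin ≤ imax)
    (p : ℕ → ℝ)
    (hp : ∀ j ∈ Finset.Icc imin imax, 0 < p j ∧ p j ≤ 1)
    (hsum : ∑ j ∈ Finset.Icc imin imax, p j = 1) :
    (∑ j ∈ Finset.Icc imin imax,
        p j • ((p j)⁻¹ • (xs j - xs (j - 1)) + xs (imin - 1)) = xs imax) ∧
    (∑ j ∈ Finset.Icc imin imax,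
        p j * ‖(p j)⁻¹ • (xs j - xs (j - 1)) + xs (imin - 1) - xs imax‖ ^ 2
      ≤ 16 * κ ^ 2 * ‖x‖ ^ 2 *
        ∑ j ∈ Finset.Icc imin imax, ρ ^ (2 * (j - 1)) / p j) := by
  have hρ0 : 0 ≤ ρ := by
    rw [hρ]
    exact div_nonneg (sub_nonneg.2 (Real.one_le_sqrt.2 hκ)) (by positivity)
  have hρ1 : ρ ≤ 1 := by
    rw [hρ, div_le_one (by positivity)]
    linarith
  have hmean : ∑ j ∈ Finset.Icc imin imax, p j • (p j)⁻¹ • (xs j - xs (j - 1)) =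
      xs imax - xs (imin - 1) := by
    rw [← sum_Icc_sub_pred xs h2]
    exact Finset.sum_congr rfl fun j hj => smul_inv_smul₀ (hp j hj).1.ne' _
  constructor
  · simp only [smul_add]
    rw [Finset.sum_add_distrib, hmean, ← Finset.sum_smul, hsum, one_smul, sub_add_cancel]
  · have hvar := sum_mul_norm_sub_mean_sq_le (Finset.Icc imin imax) p
      (fun j => (p j)⁻¹ • (xs j - xs (j - 1))) hsum
    rw [hmean] at hvar
    simp only [← sub_add, sub_add_eq_add_sub] at hvar
    refine hvar.trans ?_
    rw [Finset.mul_sum]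
    refine Finset.sum_le_sum fun j hj => ?_
    have hpj := (hp j hj).1
    have hsq := pow_le_pow_left₀ (norm_nonneg _)
      (norm_sub_pred_le_of_cg_bound (by linarith) hρ0 hρ1 hbound j) 2
    calc p j * ‖(p j)⁻¹ • (xs j - xs (j - 1))‖ ^ 2
        = ‖xs j - xs (j - 1)‖ ^ 2 / p j := by
          rw [norm_smul, Real.norm_of_nonneg (by positivity)]
          field_simp
      _ ≤ (4 * κ * ‖x‖ * ρ ^ (j - 1)) ^ 2 / p j := by gcongr
      _ = 16 * κ ^ 2 * ‖x‖ ^ 2 * (ρ ^ (2 * (j - 1)) / p j) := by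
          rw [pow_mul']
          ring
end

section
/- Under the hypotheses of the TSS-Solve variance theorem (real inner product space V, x ∈ V, iterates (x_j) with x₀ = 0 satisfying ‖x_j − x‖ ≤ κ · 2ρ^j/(1+ρ^{2j}) · ‖x‖ with κ ≥ 1 and ρ = (√κ−1)/(√κ+1), integers 1 ≤ i_min ≤ i_max, pmf p on {i_min,…,i_max}), for every δ > 0 the TSS-Solve estimator concentrates around x_{i_max}: ∑_{j ∈ {i_min,…,i_max} : ‖(x_j − x_{j−1})/p(j) + x_{i_min−1} − x_{i_max}‖ ≥ δ} p(j) ≤ 16 δ^{−2} κ² ‖x‖² Γ, where Γ = ∑_{j=i_min}^{i_max} ρ^{2(j−1)} / p(j). -/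
/-- Second moment bound for an importance-sampled sum: the variance of the estimator `d j / p j`
of `∑ d j` is at most its second moment. -/
theorem sum_mul_norm_inv_smul_sub_sum_sq_le {ι V : Type*} [NormedAddCommGroup V]
    [InnerProductSpace ℝ V] (s : Finset ι) (p : ι → ℝ) (d : ι → V) (hp : ∀ j ∈ s, 0 < p j)
    (hsum : ∑ j ∈ s, p j = 1) :
    ∑ j ∈ s, p j * ‖(p j)⁻¹ • d j - ∑ i ∈ s, d i‖ ^ 2 ≤ ∑ j ∈ s, ‖d j‖ ^ 2 / p j := by
  set m := ∑ i ∈ s, d i with hm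
  have expand : ∀ j ∈ s, p j * ‖(p j)⁻¹ • d j - m‖ ^ 2 =
      ‖d j‖ ^ 2 / p j - 2 * inner ℝ (d j) m + p j * ‖m‖ ^ 2 := by
    intro j hj
    have := hp j hj
    rw [norm_sub_sq_real, real_inner_smul_left, norm_smul, mul_pow, Real.norm_eq_abs, sq_abs]
    field_simp
  rw [Finset.sum_congr rfl expand, Finset.sum_add_distrib, Finset.sum_sub_distrib,
    ← Finset.mul_sum, ← Finset.sum_mul, ← sum_inner, ← hm, hsum, real_inner_self_eq_norm_sq]
  nlinarith [sq_nonneg ‖m‖]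

/-- Chebyshev's inequality for finite weighted sums. -/
theorem sum_filter_le_inv_sq_mul_sum {ι : Type*} (s : Finset ι) (p f : ι → ℝ)
    (hp : ∀ j ∈ s, 0 ≤ p j) {δ : ℝ} (hδ : 0 < δ) [DecidablePred fun j => δ ≤ f j] :
    ∑ j ∈ s.filter (fun j => δ ≤ f j), p j ≤ δ⁻¹ ^ 2 * ∑ j ∈ s, p j * f j ^ 2 := by
  rw [Finset.sum_filter, Finset.mul_sum]
  refine Finset.sum_le_sum fun j hj => ?_
  have hpj := hp j hj
  split_ifs with h
  · have : 1 ≤ δ⁻¹ * f j := by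
      rw [inv_mul_eq_div]
      exact (one_le_div hδ).2 h
    calc p j = p j * 1 := (mul_one _).symm
      _ ≤ p j * (δ⁻¹ * f j) ^ 2 := by gcongr; exact one_le_pow₀ this
      _ = _ := by ring
  · positivity

theorem norm_sub_pred_le {V : Type*} [SeminormedAddCommGroup V] {x : V} {xs : ℕ → V} {κ ρ : ℝ}
    (hκ : 0 ≤ κ) (hρ0 : 0 ≤ ρ) (hρ1 : ρ ≤ 1)
    (hbound : ∀ j : ℕ, ‖xs j - x‖ ≤ κ * (2 * ρ ^ j / (1 + ρ ^ (2 * j))) * ‖x‖) (j : ℕ) :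
    ‖xs j - xs (j - 1)‖ ≤ 4 * κ * ρ ^ (j - 1) * ‖x‖ := by
  have error_le (i : ℕ) : ‖xs i - x‖ ≤ κ * (2 * ρ ^ i) * ‖x‖ := by
    refine (hbound i).trans ?_
    gcongr
    exact div_le_self (by positivity) (le_add_of_nonneg_right (by positivity))
  have hpow : κ * (2 * ρ ^ j) * ‖x‖ ≤ κ * (2 * ρ ^ (j - 1)) * ‖x‖ := by
    gcongr ?_ * (2 * ?_) * _
    exact pow_le_pow_of_le_one hρ0 hρ1 (Nat.sub_le j 1)
  have tri : ‖xs j - xs (j - 1)‖ ≤ ‖xs j - x‖ + ‖xs (j - 1) - x‖ := by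
    simpa using norm_sub_le (xs j - x) (xs (j - 1) - x)
  linarith [error_le j, error_le (j - 1)]


/-- Concentration of the TSS-Solve estimator around `x_{i_max}`. -/
theorem tss_solve_concentration {V : Type*} [NormedAddCommGroup V] [InnerProductSpace ℝ V]
    (x : V) (xs : ℕ → V) (hx0 : xs 0 = 0)
    (κ : ℝ) (hκ : 1 ≤ κ)
    (ρ : ℝ) (hρ : ρ = (Real.sqrt κ - 1) / (Real.sqrt κ + 1))
    (hbound : ∀ j : ℕ, ‖xs j - x‖ ≤ κ * (2 * ρ ^ j / (1 + ρ ^ (2 * j))) * ‖x‖)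
    (imin imax : ℕ) (h1 : 1 ≤ imin) (h2 : imin ≤ imax)
    (p : ℕ → ℝ)
    (hp : ∀ j ∈ Finset.Icc imin imax, 0 < p j ∧ p j ≤ 1)
    (hsum : ∑ j ∈ Finset.Icc imin imax, p j = 1)
    (δ : ℝ) (hδ : 0 < δ) :
    ∑ j ∈ (Finset.Icc imin imax).filter
        (fun j => δ ≤ ‖(p j)⁻¹ • (xs j - xs (j - 1)) + xs (imin - 1) - xs imax‖),
      p j
      ≤ 16 * δ⁻¹ ^ 2 * κ ^ 2 * ‖x‖ ^ 2 *
        ∑ j ∈ Finset.Icc imin imax, ρ ^ (2 * (j - 1)) / p j := by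
  have hsqrt : 1 ≤ Real.sqrt κ := Real.one_le_sqrt.2 hκ
  have hρ0 : 0 ≤ ρ := hρ ▸ div_nonneg (by linarith) (by linarith)
  have hρ1 : ρ ≤ 1 := hρ ▸ (div_le_one (by linarith)).2 (by linarith)
  have hmean (j : ℕ) : (p j)⁻¹ • (xs j - xs (j - 1)) + xs (imin - 1) - xs imax =
      (p j)⁻¹ • (xs j - xs (j - 1)) - ∑ i ∈ Finset.Icc imin imax, (xs i - xs (i - 1)) := by
    rw [sum_Icc_sub_pred xs h2]
    abel
  refine (sum_filter_le_inv_sq_mul_sum _ p _ (fun j hj => (hp j hj).1.le) hδ).trans ?_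
  simp only [hmean]
  calc _ ≤ δ⁻¹ ^ 2 * ∑ j ∈ Finset.Icc imin imax, ‖xs j - xs (j - 1)‖ ^ 2 / p j := by
        refine mul_le_mul_of_nonneg_left ?_ (by positivity)
        exact sum_mul_norm_inv_smul_sub_sum_sq_le _ p (fun j => xs j - xs (j - 1))
          (fun j hj => (hp j hj).1) hsum
    _ ≤ δ⁻¹ ^ 2 * ∑ j ∈ Finset.Icc imin imax, (4 * κ * ρ ^ (j - 1) * ‖x‖) ^ 2 / p j := by
        gcongr with j hj
        · exact (hp j hj).1.le
        · exact norm_sub_pred_le (by linarith) hρ0 hρ1 hbound j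
    _ = _ := by
        rw [Finset.mul_sum, Finset.mul_sum]
        refine Finset.sum_congr rfl fun j _ => ?_
        rw [mul_comm 2 (j - 1), pow_mul]
        ring
end

section
/- Let κ ≥ 1, set ρ = (√(κ+1) − 1)/(√(κ+1) + 1), and let Φ ∈ ℝ. Let (s_j)_{j≥0} be a sequence of real numbers with s₀ = 0 satisfying the Lanczos quadrature error bound |s_j − Φ| ≤ 2 (√(κ+1) + 1) log(2κ) ρ^{2j} for every j ≥ 0. Let 1 ≤ i_min ≤ i_max be integers and p : {i_min, …, i_max} → (0,1] with ∑_{j=i_min}^{i_max} p(j) = 1, and set Δ_j := s_j − s_{j−1}. Then (i) the mean of the TSS-LogQF estimator equals s_{i_max}: ∑_{j=i_min}^{i_max} p(j) · ( Δ_j/p(j) + s_{i_min−1} ) = s_{i_max}; and (ii) its variance satisfies ∑_{j=i_min}^{i_max} p(j) · ( Δ_j/p(j) + s_{i_min−1} − s_{i_max} )² ≤ 16 (√(κ+1) + 1)² log²(2κ) Γ, where Γ = ∑_{j=i_min}^{i_max} ρ^{4(j−1)} / p(j). -/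
theorem sum_Icc_sub_pred_s6 {G : Type*} [AddCommGroup G] (s : ℕ → G) {m n : ℕ}
    (hmn : m ≤ n) : ∑ j ∈ Finset.Icc m n, (s j - s (j - 1)) = s n - s (m - 1) := by
  induction n, hmn using Nat.le_induction with
  | base => simp
  | succ n hmn ih =>
    rw [Finset.sum_Icc_succ_top (by omega), ih, Nat.add_sub_cancel]
    abel

theorem sum_mul_div_add_const {ι : Type*} {t : Finset ι} {p d : ι → ℝ} (c : ℝ)
    (hp : ∀ j ∈ t, 0 < p j) (hsum : ∑ j ∈ t, p j = 1) :
    ∑ j ∈ t, p j * (d j / p j + c) = ∑ j ∈ t, d j + c := by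
  have h : ∀ j ∈ t, p j * (d j / p j + c) = d j + p j * c := fun j hj => by
    have := (hp j hj).ne'
    field_simp
  rw [Finset.sum_congr rfl h, Finset.sum_add_distrib, ← Finset.sum_mul, hsum, one_mul]

/-- The variance of an importance-sampling estimator is at most its second moment. -/
theorem sum_mul_div_sub_sum_sq_le {ι : Type*} {t : Finset ι} {p d : ι → ℝ}
    (hp : ∀ j ∈ t, 0 < p j) (hsum : ∑ j ∈ t, p j = 1) :
    ∑ j ∈ t, p j * (d j / p j - ∑ i ∈ t, d i) ^ 2 ≤ ∑ j ∈ t, d j ^ 2 / p j := by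
  set D := ∑ i ∈ t, d i with hD
  have h : ∀ j ∈ t, p j * (d j / p j - D) ^ 2 = d j ^ 2 / p j - d j * (2 * D) + p j * D ^ 2 :=
    fun j hj => by
      have := (hp j hj).ne'
      field_simp
      ring
  rw [Finset.sum_congr rfl h, Finset.sum_add_distrib, Finset.sum_sub_distrib, ← Finset.sum_mul,
    ← Finset.sum_mul, hsum, ← hD]
  nlinarith [sq_nonneg D]

/-- Increments of a sequence converging geometrically at rate `ρ ^ 2` decay at the same rate. -/
theorem sq_sub_pred_le_of_abs_sub_le {s : ℕ → ℝ} {Φ C ρ : ℝ} (hC : 0 ≤ C) (hρ : ρ ^ 2 ≤ 1)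
    (hs : ∀ j, |s j - Φ| ≤ C * ρ ^ (2 * j)) {j : ℕ} (hj : 1 ≤ j) :
    (s j - s (j - 1)) ^ 2 ≤ 4 * C ^ 2 * ρ ^ (4 * (j - 1)) := by
  obtain ⟨k, rfl⟩ := Nat.exists_eq_add_of_le' hj
  rw [Nat.add_sub_cancel]
  have hpow : C * ρ ^ (2 * (k + 1)) ≤ C * ρ ^ (2 * k) := by
    rw [pow_mul, pow_mul]
    exact mul_le_mul_of_nonneg_left
      (pow_le_pow_of_le_one (sq_nonneg ρ) hρ k.le_succ) hC
  have hdiff : |s (k + 1) - s k| ≤ 2 * (C * ρ ^ (2 * k)) := by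
    have := abs_sub_le (s (k + 1)) Φ (s k)
    rw [abs_sub_comm Φ] at this
    linarith [hs (k + 1), hs k]
  calc (s (k + 1) - s k) ^ 2 = |s (k + 1) - s k| ^ 2 := (sq_abs _).symm
    _ ≤ (2 * (C * ρ ^ (2 * k))) ^ 2 := pow_le_pow_left₀ (abs_nonneg _) hdiff 2
    _ = 4 * C ^ 2 * ρ ^ (4 * k) := by ring


/-- Mean and variance of the TSS-LogQF estimator. -/
theorem tss_logqf_mean_variance
    (κ : ℝ) (hκ : 1 ≤ κ)
    (ρ : ℝ) (hρ : ρ = (Real.sqrt (κ + 1) - 1) / (Real.sqrt (κ + 1) + 1))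
    (Φ : ℝ) (s : ℕ → ℝ) (hs0 : s 0 = 0)
    (hbound : ∀ j : ℕ,
      |s j - Φ| ≤ 2 * (Real.sqrt (κ + 1) + 1) * Real.log (2 * κ) * ρ ^ (2 * j))
    (imin imax : ℕ) (h1 : 1 ≤ imin) (h2 : imin ≤ imax)
    (p : ℕ → ℝ)
    (hp : ∀ j ∈ Finset.Icc imin imax, 0 < p j ∧ p j ≤ 1)
    (hsum : ∑ j ∈ Finset.Icc imin imax, p j = 1) :
    (∑ j ∈ Finset.Icc imin imax,
        p j * ((s j - s (j - 1)) / p j + s (imin - 1)) = s imax) ∧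
    (∑ j ∈ Finset.Icc imin imax,
        p j * ((s j - s (j - 1)) / p j + s (imin - 1) - s imax) ^ 2
      ≤ 16 * (Real.sqrt (κ + 1) + 1) ^ 2 * Real.log (2 * κ) ^ 2 *
        ∑ j ∈ Finset.Icc imin imax, ρ ^ (4 * (j - 1)) / p j) := by
  have hpos : ∀ j ∈ Finset.Icc imin imax, 0 < p j := fun j hj => (hp j hj).1
  have htel := sum_Icc_sub_pred_s6 s h2
  refine ⟨by rw [sum_mul_div_add_const _ hpos hsum, htel, sub_add_cancel], ?_⟩
  have hsqrt : 1 ≤ Real.sqrt (κ + 1) := Real.one_le_sqrt.2 (by linarith)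
  have hlog : 0 ≤ Real.log (2 * κ) := Real.log_nonneg (by linarith)
  have hρ0 : 0 ≤ ρ := hρ ▸ div_nonneg (by linarith) (by linarith)
  have hρ1 : ρ ≤ 1 := hρ ▸ div_le_one_of_le₀ (by linarith) (by linarith)
  have hvar := sum_mul_div_sub_sum_sq_le (d := fun j => s j - s (j - 1)) hpos hsum
  rw [htel] at hvar
  simp only [sub_sub_eq_add_sub] at hvar
  refine hvar.trans ?_
  rw [Finset.mul_sum]
  refine Finset.sum_le_sum fun j hj => ?_
  have hinc := sq_sub_pred_le_of_abs_sub_le (by positivity) (pow_le_one₀ hρ0 hρ1) hbound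
    (h1.trans (Finset.mem_Icc.1 hj).1)
  rw [← mul_div_assoc]
  refine div_le_div_of_nonneg_right (hinc.trans_eq ?_) (hpos j hj).le
  ring
end
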